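/- Every admissible row of length s−1 begins or ends near the boundary of the alphabet: for every (i_1,…,i_{s−1}) ∈ B((s−1)^1), either i_1 ∈ {1,2} or i_{s−1} ∈ {2̄, 1̄}. Equivalently, there is no (i_1,…,i_{s−1}) ∈ B((s−1)^1) with all entries in {3,4,…,s,s̄,…,3̄}. -/

import Mathlib

open Complex Filter Topology

open scoped Classical

noncomputable section

namespace CsBethe

/-- `Φ(u) = (q^u - q^{-u})/(q - q⁻¹)` (with the principal branch of `log`). -/
def Phi (q u : ℂ) : ℂ := (q ^ u - q ^ (-u)) / (q - q⁻¹)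

/-- `Q_a(u) = ∏_{j < N a} Φ(u - r a j)`.  With `N 0 = 0` and `N (s+1) = 0` this
gives `Q_0 = Q_{s+1} = 1`. -/
def Q (q : ℂ) (N : ℕ → ℕ) (r : ℕ → ℕ → ℂ) (a : ℕ) (u : ℂ) : ℂ :=
  ∏ j ∈ Finset.range (N a), Phi q (u - r a j)

/-- `q` is not a root of unity. -/
def NotRootOfUnity (q : ℂ) : Prop := ∀ n : ℕ, 0 < n → q ^ n ≠ 1

/-- Numerator of the box function, built from a `Q`-like family `QF`.
Coding of the set `J = {1,…,s,s̄,…,1̄}`: the letter `j ∈ {1,…,s}` is coded by `j`,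
and the barred letter `ā` (for `1 ≤ a ≤ s`) is coded by `2s+1-a`; so codes run
through `1,…,2s` in the total order `1 ≺ ⋯ ≺ s ≺ s̄ ≺ ⋯ ≺ 1̄`. -/
def boxNumG (s : ℕ) (QF : ℕ → ℂ → ℂ) (j : ℕ) (u : ℂ) : ℂ :=
  if j = 1 then QF 1 (u - 1/2)
  else if j < s then QF (j-1) (u - ((j:ℂ)-1)/2) * QF j (u - ((j:ℂ)-4)/2)
  else if j = s then QF (s-1) (u - ((s:ℂ)-1)/2) * QF s (u - ((s:ℂ)-5)/2)
  else if j = s+1 then QF (s-1) (u - ((s:ℂ)-1)/2) * QF s (u - ((s:ℂ)+3)/2)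
  else if j < 2*s then
    QF (2*s-j) (u - (2*(s:ℂ) - ((2*s+1-j : ℕ):ℂ) - 1)/2) *
      QF (2*s+1-j) (u - (2*(s:ℂ) - ((2*s+1-j : ℕ):ℂ) + 2)/2)
  else QF 1 (u - (2*(s:ℂ)-3)/2)

/-- Denominator of the box function. -/
def boxDenG (s : ℕ) (QF : ℕ → ℂ → ℂ) (j : ℕ) (u : ℂ) : ℂ :=
  if j = 1 then QF 1 (u + 1/2)
  else if j < s then QF (j-1) (u - ((j:ℂ)-3)/2) * QF j (u - ((j:ℂ)-2)/2)
  else if j = s then QF (s-1) (u - ((s:ℂ)-3)/2) * QF s (u - ((s:ℂ)-1)/2)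
  else if j = s+1 then QF (s-1) (u - ((s:ℂ)+1)/2) * QF s (u - ((s:ℂ)-1)/2)
  else if j < 2*s then
    QF (2*s-j) (u - (2*(s:ℂ) - ((2*s+1-j : ℕ):ℂ) + 1)/2) *
      QF (2*s+1-j) (u - (2*(s:ℂ) - ((2*s+1-j : ℕ):ℂ))/2)
  else QF 1 (u - (2*(s:ℂ)-1)/2)

/-- The box function `[j]_u` (trivial vacuum). -/
def box (s : ℕ) (q : ℂ) (N : ℕ → ℕ) (r : ℕ → ℕ → ℂ) (j : ℕ) (u : ℂ) : ℂ :=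
  boxNumG s (Q q N r) j u / boxDenG s (Q q N r) j u

/-- Denominator of the box function `[j]_u`. -/
def boxDen (s : ℕ) (q : ℂ) (N : ℕ → ℕ) (r : ℕ → ℕ → ℂ) (j : ℕ) (u : ℂ) : ℂ :=
  boxDenG s (Q q N r) j u

/-- Parity: `p(1) = p(1̄) = 0`, `p(b) = 1` otherwise. -/
def parity (s j : ℕ) : ℕ := if j = 1 ∨ j = 2*s then 0 else 1

/-- Admissibility of a column `(i_1,…,i_a)` (the set `B(1^a)`), in the coding above:
entries weakly increase, strictly on the set `J_+ = {1,1̄}`, except that the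
consecutive pair `(s̄,s)` is also admissible. -/
def colAdm (s : ℕ) {a : ℕ} (i : Fin a → ℕ) : Prop :=
  (∀ k, 1 ≤ i k ∧ i k ≤ 2*s) ∧
  ∀ (k : ℕ) (h : k + 1 < a),
    ((i ⟨k, by omega⟩ ≤ i ⟨k+1, h⟩ ∧
        (((i ⟨k, by omega⟩ = 1 ∨ i ⟨k, by omega⟩ = 2*s) ∧
          (i ⟨k+1, h⟩ = 1 ∨ i ⟨k+1, h⟩ = 2*s)) → i ⟨k, by omega⟩ < i ⟨k+1, h⟩))
      ∨ (i ⟨k, by omega⟩ = s+1 ∧ i ⟨k+1, h⟩ = s))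

/-- Admissibility of a row `(i_1,…,i_m)` (the set `B(m^1)`): entries weakly increase,
strictly on `J ∖ {1,1̄}`; moreover if `i_j = d` and `i_k = d̄` with `j < k` then
`s + j - k ≥ d` (stated additively). -/
def rowAdm (s : ℕ) {m : ℕ} (i : Fin m → ℕ) : Prop :=
  (∀ k, 1 ≤ i k ∧ i k ≤ 2*s) ∧
  (∀ (k : ℕ) (h : k + 1 < m),
      i ⟨k, by omega⟩ ≤ i ⟨k+1, h⟩ ∧
        ((2 ≤ i ⟨k, by omega⟩ ∧ i ⟨k, by omega⟩ ≤ 2*s - 1 ∧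
          2 ≤ i ⟨k+1, h⟩ ∧ i ⟨k+1, h⟩ ≤ 2*s - 1) → i ⟨k, by omega⟩ < i ⟨k+1, h⟩)) ∧
  (∀ j k : Fin m, (j:ℕ) < (k:ℕ) → ∀ d : ℕ, 1 ≤ d → d ≤ s →
      i j = d → i k = 2*s + 1 - d → (k:ℕ) + d ≤ s + (j:ℕ))

/-- The column dressed vacuum form `𝒯^a(u)`. -/
def Tcol (s : ℕ) (q : ℂ) (N : ℕ → ℕ) (r : ℕ → ℕ → ℂ) (a : ℕ) (u : ℂ) : ℂ :=
  ∑ i : Fin a → Fin (2*s+1),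
    if colAdm s (fun k => ((i k : ℕ))) then
      (-1 : ℂ) ^ (∑ k : Fin a, parity s ((i k : ℕ))) *
        ∏ j : Fin a, box s q N r ((i j : ℕ)) (u + ((a:ℂ) - 1 - 2*((j:ℕ):ℂ))/2)
    else 0

/-- The row dressed vacuum form `T_m^{(1)}(u)`. -/
def Trow (s : ℕ) (q : ℂ) (N : ℕ → ℕ) (r : ℕ → ℕ → ℂ) (m : ℕ) (u : ℂ) : ℂ :=
  ∑ i : Fin m → Fin (2*s+1),
    if rowAdm s (fun k => ((i k : ℕ))) then
      (-1 : ℂ) ^ (∑ k : Fin m, parity s ((i k : ℕ))) *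
        ∏ j : Fin m, box s q N r ((i j : ℕ)) (u + (2*((j:ℕ):ℂ) + 1 - (m:ℂ))/2)
    else 0

/-- `u` is a good point for `𝒯^a`: no `Q`-factor occurring in a denominator of a box
of `𝒯^a` vanishes there. -/
def colGood (s : ℕ) (q : ℂ) (N : ℕ → ℕ) (r : ℕ → ℕ → ℂ) (a : ℕ) (u : ℂ) : Prop :=
  ∀ j : ℕ, 1 ≤ j → j ≤ 2*s → ∀ p : Fin a,
    boxDen s q N r j (u + ((a:ℂ) - 1 - 2*((p:ℕ):ℂ))/2) ≠ 0

/-- `u` is a good point for `T_m^{(1)}`: no `Q`-factor occurring in a denominator of a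
box of `T_m^{(1)}` vanishes there. -/
def rowGood (s : ℕ) (q : ℂ) (N : ℕ → ℕ) (r : ℕ → ℕ → ℂ) (m : ℕ) (u : ℂ) : Prop :=
  ∀ j : ℕ, 1 ≤ j → j ≤ 2*s → ∀ p : Fin m,
    boxDen s q N r j (u + (2*((p:ℕ):ℂ) + 1 - (m:ℂ))/2) ≠ 0

/-- The Bethe ansatz equations for `C(s)` (distinguished simple roots, trivial vacuum). -/
def BAE (s : ℕ) (q : ℂ) (N : ℕ → ℕ) (r : ℕ → ℕ → ℂ) : Prop :=
  (∀ k < N 1, Q q N r 2 (r 1 k + 1/2) = Q q N r 2 (r 1 k - 1/2)) ∧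
  (∀ a, 2 ≤ a → a ≤ s - 2 → ∀ k < N a,
      (-1 : ℂ) =
        Q q N r (a-1) (r a k + 1/2) * Q q N r a (r a k - 1) * Q q N r (a+1) (r a k + 1/2) /
        (Q q N r (a-1) (r a k - 1/2) * Q q N r a (r a k + 1) * Q q N r (a+1) (r a k - 1/2))) ∧
  (∀ k < N (s-1),
      (-1 : ℂ) =
        Q q N r (s-2) (r (s-1) k + 1/2) * Q q N r (s-1) (r (s-1) k - 1) *
            Q q N r s (r (s-1) k + 1) /
        (Q q N r (s-2) (r (s-1) k - 1/2) * Q q N r (s-1) (r (s-1) k + 1) *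
            Q q N r s (r (s-1) k - 1))) ∧
  (∀ k < N s,
      (-1 : ℂ) =
        Q q N r (s-1) (r s k + 1) * Q q N r s (r s k - 2) /
        (Q q N r (s-1) (r s k - 1) * Q q N r s (r s k + 2)))

/-- Genericity of the Bethe roots: within each color the roots are pairwise distinct and,
more generally, no two (shifted) candidate pole locations coincide: differences of roots
of any two colors are never nonzero half-integers, and roots of different colors never
coincide.  In particular all BAE ratios are well defined. -/
def Generic (s : ℕ) (N : ℕ → ℕ) (r : ℕ → ℕ → ℂ) : Prop :=
  ∀ a b, 1 ≤ a → a ≤ s → 1 ≤ b → b ≤ s → ∀ j < N a, ∀ k < N b, ∀ t : ℤ,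
    r a j - r b k = (t : ℂ) / 2 → a = b ∧ j = k ∧ t = 0

/-- The residue of `f` at `v0` vanishes: `(v - v0) · f v → 0` as `v → v0`, `v ≠ v0`. -/
def ResidueZero (f : ℂ → ℂ) (v0 : ℂ) : Prop :=
  Filter.Tendsto (fun v => (v - v0) * f v) (𝓝[≠] v0) (𝓝 0)

/-- `f` has a removable singularity at `v0`: some function differentiable at `v0`
agrees with `f` on a punctured neighbourhood of `v0`. -/
def RemovableAt (f : ℂ → ℂ) (v0 : ℂ) : Prop :=
  ∃ F : ℂ → ℂ, DifferentiableAt ℂ F v0 ∧ ∀ᶠ v in 𝓝[≠] v0, F v = f v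

/-- The deformed dressed vacuum form
`𝒯_c(u) = Q_1(u - c/2) · T_{s-1}^{(1)}(u + (c-s+1)/2) / Q_1(u + c/2 - s + 1)`. -/
def Tdef (s : ℕ) (q : ℂ) (N : ℕ → ℕ) (r : ℕ → ℕ → ℂ) (c : ℂ) (u : ℂ) : ℂ :=
  Q q N r 1 (u - c/2) * Trow s q N r (s-1) (u + (c - (s:ℂ) + 1)/2) /
    Q q N r 1 (u + c/2 - (s:ℂ) + 1)

/-- The entries of an admissible row weakly increase. -/
theorem rowAdm.monotone {s m : ℕ} {i : Fin m → ℕ} (hadm : rowAdm s i) : Monotone i := by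
  rintro ⟨p, hp⟩ ⟨q, hq⟩ hpq
  induction q, (show p ≤ q from hpq) using Nat.le_induction with
  | base => exact le_rfl
  | succ q hpq' ih => exact (ih (by omega) hpq').trans (hadm.2.1 q hq).1

/-- An admissible row with no entry in `{1, 1̄}` strictly increases. -/
theorem rowAdm.strictMono {s m : ℕ} {i : Fin m → ℕ} (hadm : rowAdm s i)
    (hi : ∀ k, 2 ≤ i k ∧ i k ≤ 2 * s - 1) : StrictMono i := by
  rintro ⟨p, hp⟩ ⟨q, hq⟩ hpq
  have hpq' : p < q := hpq
  exact ((hadm.2.1 p (by omega)).2 ⟨(hi _).1, (hi _).2, (hi _).1, (hi _).2⟩).trans_le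
    (hadm.monotone (show p + 1 ≤ q by omega))

/-- In a strictly increasing admissible row of length `s - 1` with all entries in
`{3,…,s,s̄,…,3̄}`, at most `n` entries lie outside the letters from `n + 3` to its
barred partner: the pairs `(d, d̄)` contribute at most one entry each. -/
theorem rowAdm.exists_window {s : ℕ} {i : Fin (s - 1) → ℕ} (hadm : rowAdm s i)
    (hmono : StrictMono i) (hi : ∀ k, 3 ≤ i k ∧ i k ≤ 2 * s - 2) (n : ℕ) (hn : n + 2 ≤ s) :
    ∃ a b : ℕ, a + b ≤ n ∧ ∀ (p : ℕ) (hp : p < s - 1), a ≤ p → p + b < s - 1 →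
      n + 3 ≤ i ⟨p, hp⟩ ∧ i ⟨p, hp⟩ + (n + 3) ≤ 2 * s + 1 := by
  induction n with
  | zero =>
    refine ⟨0, 0, le_rfl, fun p hp _ _ => ?_⟩
    have := hi ⟨p, hp⟩
    omega
  | succ n ih =>
    obtain ⟨a, b, hab, hwin⟩ := ih (by omega)
    have ha : a < s - 1 := by omega
    have hb : s - 2 - b < s - 1 := by omega
    have hfirst := hwin a ha le_rfl (by omega)
    have hlast := hwin (s - 2 - b) hb (by omega) (by omega)
    have hgt : ∀ (p : ℕ) (hp : p < s - 1), a < p → i ⟨a, ha⟩ < i ⟨p, hp⟩ :=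
      fun p hp h => hmono (show a < p from h)
    have hlt : ∀ (p : ℕ) (hp : p < s - 1), p < s - 2 - b → i ⟨p, hp⟩ < i ⟨s - 2 - b, hb⟩ :=
      fun p hp h => hmono (show p < s - 2 - b from h)
    have hge : ∀ (p : ℕ) (hp : p < s - 1), a ≤ p → i ⟨a, ha⟩ ≤ i ⟨p, hp⟩ :=
      fun p hp h => hmono.monotone (show a ≤ p from h)
    have hle : ∀ (p : ℕ) (hp : p < s - 1), p ≤ s - 2 - b → i ⟨p, hp⟩ ≤ i ⟨s - 2 - b, hb⟩ :=
      fun p hp h => hmono.monotone (show p ≤ s - 2 - b from h)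
    by_cases h₁ : i ⟨a, ha⟩ = n + 3
    · by_cases h₂ : i ⟨s - 2 - b, hb⟩ = 2 * s + 1 - (n + 3)
      · have hpair : s - 2 - b + (n + 3) ≤ s + a :=
          hadm.2.2 ⟨a, ha⟩ ⟨s - 2 - b, hb⟩ (show a < s - 2 - b by omega) (n + 3)
            (by omega) (by omega) h₁ h₂
        omega
      · refine ⟨a + 1, b, by omega, fun p hp hap hpb => ?_⟩
        have := hgt p hp (by omega)
        have := hle p hp (by omega)
        omega
    · by_cases h₂ : i ⟨s - 2 - b, hb⟩ = 2 * s + 1 - (n + 3)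
      · refine ⟨a, b + 1, by omega, fun p hp hap hpb => ?_⟩
        have := hge p hp (by omega)
        have := hlt p hp (by omega)
        omega
      · refine ⟨a, b, by omega, fun p hp hap hpb => ?_⟩
        have := hge p hp (by omega)
        have := hle p hp (by omega)
        omega

/-- every admissible row of length `s-1` begins with `1` or `2`
or ends with `2̄` or `1̄` (codes `2s-1` and `2s`); equivalently no admissible row of
length `s-1` has all entries in `{3,…,s,s̄,…,3̄}`. -/
theorem row_boundary
    (s : ℕ) (hs : 3 ≤ s) (i : Fin (s-1) → ℕ) (hadm : rowAdm s i) :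
    i ⟨0, by omega⟩ = 1 ∨ i ⟨0, by omega⟩ = 2 ∨
    i ⟨s-2, by omega⟩ = 2*s - 1 ∨ i ⟨s-2, by omega⟩ = 2*s := by
  by_contra! hne
  obtain ⟨h1, h2, h3, h4⟩ := hne
  have hi : ∀ k, 3 ≤ i k ∧ i k ≤ 2 * s - 2 := by
    rintro ⟨p, hp⟩
    have hlo : i ⟨0, by omega⟩ ≤ i ⟨p, hp⟩ := hadm.monotone (show 0 ≤ p by omega)
    have hhi : i ⟨p, hp⟩ ≤ i ⟨s-2, by omega⟩ := hadm.monotone (show p ≤ s - 2 by omega)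
    have := hadm.1 ⟨0, by omega⟩
    have := hadm.1 ⟨s-2, by omega⟩
    omega
  have hmono : StrictMono i := hadm.strictMono fun k => by
    have := hi k
    omega
  obtain ⟨a, b, hab, hwin⟩ := hadm.exists_window hmono hi (s - 2) (by omega)
  have := hwin a (by omega) le_rfl (by omega)
  omega

end CsBethe
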